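/- Let U be an optimal prefix-free machine and let b : {0,1}* × {0,1}* → {0,1}* be a fixed bijective total recursive pairing function, with joint complexity H(n,s) = H_U(b(n,s)). Then there exist an optimal prefix-free machine V and d ∈ ℕ such that: (i) #S_V(n,s) ≤ 2^{n − H(n,s) + d} for all n ∈ ℕ and all finite binary strings s; and (ii) 2^{n − H(n,s) − d} ≤ #S_V(n,s) for all n ∈ ℕ and all finite binary strings s with n − H(n,s) ≥ d. Here S_V(n,s) = {p ∈ {0,1}* : |p| ≤ n and V(p) = s} and n is identified with a finite binary string via the bijection φ(s) = (the dyadic integer 1s) − 1. -/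

import Mathlib

open scoped ENNReal

/-- A set of binary strings is prefix-free: no element is a proper prefix of another. -/
def PrefixFreeSet (S : Set (List Bool)) : Prop :=
  ∀ p ∈ S, ∀ q ∈ S, p <+: q → p = q

/-- A prefix-free machine: a partial recursive function on binary strings
whose domain is a prefix-free set. -/
def PFMachine (C : List Bool →. List Bool) : Prop :=
  Partrec C ∧ PrefixFreeSet C.Dom

/-- `Hm C s` is the length of a shortest program `p` with `C p = s` (`∞` if none). -/
noncomputable def Hm (C : List Bool →. List Bool) (s : List Bool) : ℕ∞ :=
  sInf ((fun p : List Bool => (p.length : ℕ∞)) '' {p | s ∈ C p})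

/-- An optimal prefix-free machine: for every prefix-free machine `C` there is `d ∈ ℕ`
such that every `p ∈ dom C` has a `q` with `U q = C p` and `|q| ≤ |p| + d`. -/
def OptimalPFM (U : List Bool →. List Bool) : Prop :=
  PFMachine U ∧ ∀ C : List Bool →. List Bool, PFMachine C →
    ∃ d : ℕ, ∀ p s, s ∈ C p → ∃ q : List Bool, s ∈ U q ∧ q.length ≤ p.length + d

/-- The binary string identified with `n : ℕ` via `φ(s) = (the dyadic integer 1s) − 1`. -/
def strOfNat (n : ℕ) : List Bool := ((n + 1).bits.dropLast).reverse


/-- Effective choice: search for a witness `b` on which `f (a, b)` is defined. -/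
theorem exists_selector {α β σ : Type} [Primcodable α] [Primcodable β] [Primcodable σ]
    (f : α × β →. σ) (hf : Partrec f) :
    ∃ g : α →. σ, Partrec g ∧ (∀ a s, s ∈ g a → ∃ b, s ∈ f (a, b)) ∧
      (∀ a b s, s ∈ f (a, b) → ∃ s', s' ∈ g a) := by
  obtain ⟨c, hc⟩ := Nat.Partrec.Code.exists_code.1 hf
  have key : ∀ a b s, s ∈ f (a, b) ↔ Encodable.encode s ∈ c.eval (Encodable.encode (a, b)) := by
    intro a b s
    rw [hc]
    simp
  let F : α → ℕ → Option σ := fun a k =>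
    (Encodable.decode (α := β × ℕ) k).bind fun bt =>
      (Nat.Partrec.Code.evaln bt.2 c (Encodable.encode (a, bt.1))).bind fun m =>
        Encodable.decode (α := σ) m
  have hF : Computable₂ F := by
    refine Primrec.to_comp ?_
    refine Primrec.option_bind (Primrec.decode.comp Primrec.snd) ?_
    refine Primrec.option_bind ?_ (Primrec.decode.comp Primrec.snd)
    refine Nat.Partrec.Code.primrec_evaln.comp (Primrec.pair (Primrec.pair
      (Primrec.snd.comp Primrec.snd) (Primrec.const c)) (Primrec.encode.comp
        (Primrec.pair (Primrec.fst.comp Primrec.fst) (Primrec.fst.comp Primrec.snd))))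
  have hF1 : ∀ a k s, s ∈ F a k → ∃ b, s ∈ f (a, b) := by
    intro a k s h
    simp only [F, Option.mem_def, Option.bind_eq_some_iff] at h
    obtain ⟨⟨b, t⟩, -, m, hm, hs⟩ := h
    refine ⟨b, ?_⟩
    have := Nat.Partrec.Code.evaln_sound hm
    rw [hc] at this
    simp at this
    obtain ⟨s', hs', rfl⟩ := this
    simp at hs
    exact hs ▸ hs'
  refine ⟨fun a => Nat.rfindOpt (F a), Partrec.rfindOpt hF, ?_, ?_⟩
  · intro a s h
    obtain ⟨k, hk⟩ := Nat.rfindOpt_spec h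
    exact hF1 a k s hk
  · intro a b s h
    rw [key] at h
    obtain ⟨t, ht⟩ := Nat.Partrec.Code.evaln_complete.1 h
    have : (Nat.rfindOpt (F a)).Dom := by
      rw [Nat.rfindOpt_dom]
      refine ⟨Encodable.encode (b, t), s, ?_⟩
      simp only [F, Encodable.encodek, Option.bind_some, Option.mem_def] 
      rw [Option.mem_def] at ht
      rw [ht]
      simp
    exact ⟨_, Part.get_mem this⟩

theorem primrec_bits : Primrec Nat.bits := by
  have : Primrec₂ (fun (_ : Unit) (n : ℕ) => Nat.bits n) := by
    refine Primrec.nat_strong_rec _ (g := fun _ l =>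
      some (if l.length = 0 then [] else l.length.bodd :: l.getD l.length.div2 [])) ?_ ?_
    · refine Primrec.option_some.comp ?_
      have hl : Primrec (fun p : Unit × List (List Bool) => p.2.length) :=
        Primrec.list_length.comp Primrec.snd
      refine Primrec.ite (Primrec.eq.comp hl (Primrec.const 0)) (Primrec.const _) ?_
      exact Primrec.list_cons.comp (Primrec.nat_bodd.comp hl)
        ((Primrec.list_getD []).comp Primrec.snd (Primrec.nat_div2.comp hl))
    · intro _ n
      simp only [List.length_map, List.length_range]
      by_cases hn : n = 0
      · simp [hn]
      · have : n.div2 < n := by rw [Nat.div2_val]; omega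
        simp only [hn, if_false, Option.some.injEq]
        rw [List.getD_eq_getElem?_getD, List.getElem?_map, List.getElem?_range this]
        simp only [Option.map_some, Option.getD_some]
        conv_rhs => rw [← Nat.bit_bodd_div2 n]
        rw [Nat.bits_append_bit]
        intro h0
        rw [Nat.div2_val] at h0
        have : n = 1 := by omega
        simp [this]
  exact this.comp (Primrec.const ()) Primrec.id

theorem primrec_strOfNat : Primrec strOfNat := by
  have : Primrec fun n : ℕ => ((n + 1).bits.reverse).tail :=
    Primrec.list_tail.comp (Primrec.list_reverse.comp (primrec_bits.comp Primrec.succ))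
  refine this.of_eq fun n => ?_
  simp [strOfNat]

theorem bits_getLast (n : ℕ) (hn : n ≠ 0) : ∃ l, n.bits = l ++ [true] := by
  induction n using Nat.binaryRec' with
  | zero => exact absurd rfl hn
  | bit b n h ih =>
    rw [Nat.bits_append_bit _ _ h]
    by_cases h0 : n = 0
    · exact ⟨[], by simp [h0, h h0]⟩
    · obtain ⟨l, hl⟩ := ih h0
      exact ⟨b :: l, by simp [hl]⟩

theorem bits_inj (n : ℕ) : ∀ m : ℕ, n.bits = m.bits → n = m := by
  induction n using Nat.binaryRec' with
  | zero =>
    intro m h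
    by_contra hm
    obtain ⟨l, hl⟩ := bits_getLast m (Ne.symm hm)
    simp [hl] at h
  | bit b n h ih =>
    intro m hm
    have h1 := Nat.bodd_eq_bits_head m
    have h2 := Nat.div2_bits_eq_tail m
    rw [← hm, Nat.bits_append_bit _ _ h] at h1 h2
    simp only [List.headI_cons, List.tail_cons] at h1 h2
    rw [ih _ h2.symm, ← h1, Nat.bit_bodd_div2]

theorem strOfNat_inj {n m : ℕ} (h : strOfNat n = strOfNat m) : n = m := by
  obtain ⟨l, hl⟩ := bits_getLast (n + 1) (by omega)
  obtain ⟨k, hk⟩ := bits_getLast (m + 1) (by omega)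
  simp only [strOfNat, hl, hk, List.dropLast_concat, List.reverse_inj] at h
  have := bits_inj (n + 1) (m + 1) (by rw [hl, hk, h])
  omega

/-- A self-delimiting code of `j` of length `j / 2 + 2`. -/
def jcode (j : ℕ) : List Bool :=
  (List.range (j / 2)).map (fun _ => true) ++ [false, j.bodd]

theorem jcode_length (j : ℕ) : (jcode j).length = j / 2 + 2 := by simp [jcode]

theorem primrec_jcode : Primrec jcode := by
  refine Primrec.list_append.comp
    (Primrec.list_map (Primrec.list_range.comp
      (Primrec.nat_div.comp Primrec.id (Primrec.const 2))) (Primrec.const true).to₂) ?_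
  exact Primrec.list_cons.comp (Primrec.const false)
    (Primrec.list_cons.comp Primrec.nat_bodd (Primrec.const []))

theorem jcode_prefix {i j : ℕ} {u v r : List Bool} (h1 : jcode i ++ u <+: r)
    (h2 : jcode j ++ v <+: r) : i = j := by
  obtain ⟨x, rfl⟩ := h1
  obtain ⟨y, hy⟩ := h2
  have hg : ∀ k : ℕ, ((jcode j ++ v ++ y)[k]?) = ((jcode i ++ u ++ x)[k]?) := by
    intro k; rw [hy]
  simp only [jcode, List.append_assoc, List.cons_append, List.nil_append] at hg
  have e1 := hg (i / 2)
  have e2 := hg (j / 2)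
  have e3 := hg (i / 2 + 1)
  simp only [List.getElem?_append, List.length_map, List.length_range, List.getElem?_map] at e1 e2 e3
  have hij : i / 2 = j / 2 := by
    rcases lt_trichotomy (i / 2) (j / 2) with h | h | h
    · simp [h] at e1
    · exact h
    · simp [h] at e2
  simp [hij] at e3
  have a := Nat.bodd_add_div2 i
  have b := Nat.bodd_add_div2 j
  rw [Nat.div2_val] at a b
  rw [← a, ← b, e3, hij]

theorem primrec_lbeq : Primrec₂ (fun x y : List Bool => x == y) :=
  (Primrec.beq (α := List Bool)).of_eq fun a b => by
    rw [Bool.eq_iff_iff]; simp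

theorem computable_lbeq {α : Type} [Primcodable α] {f g : α → List Bool}
    (hf : Computable f) (hg : Computable g) : Computable (fun a => f a == g a) :=
  primrec_lbeq.to_comp.comp hf hg

theorem computable_pair_b {α : Type} [Primcodable α] {b : List Bool × List Bool → List Bool}
    (hbc : Computable b) {f : α → ℕ} {g : α → List Bool}
    (hf : Primrec f) (hg : Primrec g) : Computable (fun a => b (strOfNat (f a), g a)) :=
  hbc.comp (Primrec.pair (primrec_strOfNat.comp hf) hg).to_comp

theorem partrec_guard {α σ : Type} [Primcodable α] [Primcodable σ] {c : α → Bool} {f : α →. σ}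
    (hc : Computable c) (hf : Partrec f) :
    Partrec fun a => cond (c a) (f a) Part.none :=
  Partrec.cond hc hf Partrec.none

theorem mem_guard {σ : Type} {c : Bool} {f : Part σ} {s : σ} :
    s ∈ cond c f Part.none ↔ c = true ∧ s ∈ f := by
  cases c <;> simp

theorem prefix_of_two {S : Set (List Bool)} (hS : PrefixFreeSet S) {p q r : List Bool}
    (hp : p ∈ S) (hq : q ∈ S) (h1 : p <+: r) (h2 : q <+: r) : p = q := by
  rcases List.prefix_or_prefix_of_prefix h1 h2 with h | h
  · exact hS p hp q hq h
  · exact (hS q hq p hp h).symm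

/-- Programs `jcode j ++ q` where `q` is a program of `U`. -/
theorem shift_machine (U : List Bool →. List Bool) (hU : OptimalPFM U)
    (h : (List Bool × List Bool) × ℕ →. List Bool) (hh : Partrec h) :
    ∃ d : ℕ, ∀ j q x y, x ∈ U q → y ∈ h ((q, x), j) →
      ∃ r, y ∈ U r ∧ r.length ≤ q.length + j / 2 + d := by
  let f : List Bool × (ℕ × List Bool) →. List Bool := fun a =>
    (U a.2.2).bind fun x => cond (jcode a.2.1 ++ a.2.2 == a.1) (h ((a.2.2, x), a.2.1)) Part.none
  have hf : Partrec f := by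
    refine Partrec.bind (hU.1.1.comp (Computable.snd.comp Computable.snd)) ?_
    refine partrec_guard ?_ (hh.comp ?_)
    · refine Primrec.to_comp (primrec_lbeq.comp (Primrec.list_append.comp (primrec_jcode.comp ?_) ?_) ?_)
      · exact Primrec.fst.comp (Primrec.snd.comp Primrec.fst)
      · exact Primrec.snd.comp (Primrec.snd.comp Primrec.fst)
      · exact Primrec.fst.comp Primrec.fst
    · exact Primrec.to_comp (Primrec.pair (Primrec.pair
        (Primrec.snd.comp (Primrec.snd.comp Primrec.fst)) Primrec.snd)
          (Primrec.fst.comp (Primrec.snd.comp Primrec.fst)))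
  have mf : ∀ r j q y, y ∈ f (r, (j, q)) ↔
      ∃ x, x ∈ U q ∧ jcode j ++ q = r ∧ y ∈ h ((q, x), j) := by
    intro r j q y
    simp only [f, Part.mem_bind_iff, mem_guard, beq_iff_eq]
  obtain ⟨g, hg, g1, g2⟩ := exists_selector f hf
  have hpf : PFMachine g := by
    refine ⟨hg, ?_⟩
    intro p hp p' hp' hpp
    obtain ⟨y, hy⟩ := Part.dom_iff_mem.1 hp
    obtain ⟨y', hy'⟩ := Part.dom_iff_mem.1 hp'
    obtain ⟨⟨j, q⟩, hb⟩ := g1 _ _ hy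
    obtain ⟨⟨j', q'⟩, hb'⟩ := g1 _ _ hy'
    obtain ⟨x, hx, rfl, -⟩ := (mf _ _ _ _).1 hb
    obtain ⟨x', hx', rfl, -⟩ := (mf _ _ _ _).1 hb'
    have hj := jcode_prefix hpp (List.prefix_refl _)
    subst hj
    rw [List.prefix_append_right_inj] at hpp
    rw [hU.1.2 q (Part.dom_iff_mem.2 ⟨_, hx⟩) q' (Part.dom_iff_mem.2 ⟨_, hx'⟩) hpp]
  obtain ⟨d, hd⟩ := hU.2 g hpf
  refine ⟨d + 2, fun j q x y hx hy => ?_⟩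
  obtain ⟨y', hy'⟩ := g2 _ _ _ ((mf (jcode j ++ q) j q y).2 ⟨x, hx, rfl, hy⟩)
  obtain ⟨⟨j', q'⟩, hb'⟩ := g1 _ _ hy'
  obtain ⟨x', hx', e, hy''⟩ := (mf _ _ _ _).1 hb'
  have hj := jcode_prefix (i := j) (j := j') (List.prefix_refl _) ⟨[], by rw [List.append_nil, e]⟩
  subst hj
  rw [List.append_right_inj] at e
  subst e
  obtain rfl := Part.mem_unique hx hx'
  obtain rfl := Part.mem_unique hy hy''
  obtain ⟨r, hr, hl⟩ := hd _ _ hy'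
  refine ⟨r, hr, ?_⟩
  rw [List.length_append, jcode_length] at hl
  omega

theorem Hm_le (U : List Bool →. List Bool) {x q : List Bool} (h : x ∈ U q) :
    (Hm U x).toNat ≤ q.length := by
  have : Hm U x ≤ (q.length : ℕ∞) := sInf_le ⟨q, h, rfl⟩
  exact ENat.toNat_le_of_le_natCast this

theorem Hm_attained (U : List Bool →. List Bool) (hU : OptimalPFM U) (x : List Bool) :
    ∃ q, x ∈ U q ∧ q.length = (Hm U x).toNat := by
  have hne : ∃ q, x ∈ U q := by
    have hC : PFMachine (fun p => cond (p == []) (Part.some x) Part.none) := by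
      refine ⟨partrec_guard (computable_lbeq Computable.id (Computable.const []))
        (Computable.const x).partrec, ?_⟩
      intro p hp q hq _
      obtain ⟨y, hy⟩ := Part.dom_iff_mem.1 hp
      obtain ⟨z, hz⟩ := Part.dom_iff_mem.1 hq
      have hy := (mem_guard.1 hy).1
      have hz := (mem_guard.1 hz).1
      simp only [beq_iff_eq] at hy hz
      rw [hy, hz]
    obtain ⟨d, hd⟩ := hU.2 _ hC
    obtain ⟨q, hq, -⟩ := hd [] x (by simp)
    exact ⟨q, hq⟩
  obtain ⟨q, hq⟩ := hne
  have hm : sInf ((fun p : List Bool => (p.length : ℕ∞)) '' {p | x ∈ U p}) ∈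
      ((fun p : List Bool => (p.length : ℕ∞)) '' {p | x ∈ U p}) :=
    csInf_mem ⟨_, q, hq, rfl⟩
  obtain ⟨r, hr, hl⟩ := hm
  refine ⟨r, hr, ?_⟩
  simp only at hl
  rw [Hm, ← hl, ENat.toNat_natCast]

theorem Hm_shift_one (U : List Bool →. List Bool) (hU : OptimalPFM U)
    (b : List Bool × List Bool → List Bool) (hbc : Computable b) :
    ∃ c : ℕ, ∀ j q s, s ∈ U q →
      (Hm U (b (strOfNat (q.length + j), s))).toNat ≤ q.length + j / 2 + c := by
  obtain ⟨d, hd⟩ := shift_machine U hU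
    (fun a => Part.some (b (strOfNat (a.1.1.length + a.2), a.1.2)))
    (Computable.partrec (computable_pair_b hbc
      (Primrec.nat_add.comp (Primrec.list_length.comp (Primrec.fst.comp Primrec.fst)) Primrec.snd)
        (Primrec.snd.comp Primrec.fst)))
  refine ⟨d, fun j q s hs => ?_⟩
  obtain ⟨r, hr, hl⟩ := hd j q s _ hs (Part.mem_some _)
  exact (Hm_le U hr).trans hl

theorem Hm_shift_two (U : List Bool →. List Bool) (hU : OptimalPFM U)
    (b : List Bool × List Bool → List Bool) (hb : Function.Bijective b) (hbc : Computable b) :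
    ∃ c : ℕ, ∀ j m s, (Hm U (b (strOfNat (m + j), s))).toNat ≤
      (Hm U (b (strOfNat m, s))).toNat + j / 2 + c := by
  let f : ((List Bool × List Bool) × ℕ) × (ℕ × List Bool) →. List Bool := fun a =>
    cond (b (strOfNat a.2.1, a.2.2) == a.1.1.2) (Part.some (b (strOfNat (a.2.1 + a.1.2), a.2.2)))
      Part.none
  have hf : Partrec f := by
    refine partrec_guard ?_ (Computable.partrec ?_)
    · exact computable_lbeq (computable_pair_b hbc (Primrec.fst.comp Primrec.snd)
        (Primrec.snd.comp Primrec.snd))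
          (Primrec.snd.comp (Primrec.fst.comp Primrec.fst)).to_comp
    · exact computable_pair_b hbc (Primrec.nat_add.comp
        (Primrec.fst.comp Primrec.snd) (Primrec.snd.comp Primrec.fst))
          (Primrec.snd.comp Primrec.snd)
  obtain ⟨g, hg, g1, g2⟩ := exists_selector f hf
  obtain ⟨d, hd⟩ := shift_machine U hU g hg
  refine ⟨d, fun j m s => ?_⟩
  obtain ⟨q, hq, hl⟩ := Hm_attained U hU (b (strOfNat m, s))
  have hin : b (strOfNat (m + j), s) ∈ g ((q, b (strOfNat m, s)), j) := by
    obtain ⟨y, hy⟩ := g2 ((q, b (strOfNat m, s)), j) (m, s) (b (strOfNat (m + j), s))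
      (mem_guard.2 ⟨by simp, Part.mem_some _⟩)
    obtain ⟨⟨m', s'⟩, h'⟩ := g1 _ _ hy
    obtain ⟨e, hy2⟩ := mem_guard.1 h'
    simp only [beq_iff_eq, Part.mem_some_iff] at e hy2
    have e := hb.1 e
    simp only [Prod.mk.injEq] at e
    obtain ⟨e1, rfl⟩ := e
    obtain rfl := strOfNat_inj e1
    rw [← hy2]
    exact hy
  obtain ⟨r, hr, hr2⟩ := hd j q _ _ hq hin
  rw [← hl]
  exact (Hm_le U hr).trans hr2

/-- The optimal machine with controlled number of programs. -/
theorem exists_V (U : List Bool →. List Bool) (hU : OptimalPFM U)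
    (b : List Bool × List Bool → List Bool) (hb : Function.Bijective b) (hbc : Computable b) :
    ∃ (V : List Bool →. List Bool) (G : List Bool × ℕ →. List Bool), PFMachine V ∧
      (∀ x q, x ∈ U q → ∃ q', q' ∈ G (x, q.length) ∧ x ∈ U q' ∧ q'.length = q.length) ∧
      (∀ p s, s ∈ V p ↔ ∃ q w, q ++ w = p ∧ b (strOfNat p.length, s) ∈ U q ∧
        q ∈ G (b (strOfNat p.length, s), q.length)) := by
  let f0 : (List Bool × ℕ) × List Bool →. List Bool := fun a =>
    (U a.2).bind fun x => cond (x == a.1.1 && a.2.length == a.1.2) (Part.some a.2) Part.none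
  have hf0 : Partrec f0 := by
    refine Partrec.bind (hU.1.1.comp Computable.snd) ?_
    refine partrec_guard (Primrec.to_comp ?_) (Computable.partrec (Primrec.to_comp ?_))
    · refine Primrec.and.comp (primrec_lbeq.comp ?_ ?_) (Primrec.beq.comp ?_ ?_)
      · exact Primrec.snd
      · exact Primrec.fst.comp (Primrec.fst.comp Primrec.fst)
      · exact Primrec.list_length.comp (Primrec.snd.comp Primrec.fst)
      · exact Primrec.snd.comp (Primrec.fst.comp Primrec.fst)
    · exact Primrec.snd.comp Primrec.fst
  have mf0 : ∀ x l q q', q' ∈ f0 ((x, l), q) ↔ x ∈ U q ∧ q.length = l ∧ q' = q := by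
    intro x l q q'
    simp only [f0, Part.mem_bind_iff, mem_guard, Bool.and_eq_true, beq_iff_eq, Part.mem_some_iff]
    constructor
    · rintro ⟨y, h1, ⟨rfl, h2⟩, h3⟩
      exact ⟨h1, h2, h3⟩
    · rintro ⟨h1, h2, h3⟩
      exact ⟨x, h1, ⟨rfl, h2⟩, h3⟩
  obtain ⟨G, hG, G1, G2⟩ := exists_selector f0 hf0
  let f : List Bool × (List Bool × List Bool × List Bool) →. List Bool := fun a =>
    (U a.2.1).bind fun x => (G (x, a.2.1.length)).bind fun q' =>
      cond ((a.2.1 ++ a.2.2.1 == a.1 && q' == a.2.1) && b (strOfNat a.1.length, a.2.2.2) == x)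
        (Part.some a.2.2.2) Part.none
  have hf : Partrec f := by
    refine Partrec.bind (hU.1.1.comp (Computable.fst.comp Computable.snd)) ?_
    refine Partrec.bind (hG.comp (Primrec.to_comp ?_)) ?_
    · exact Primrec.pair Primrec.snd
        (Primrec.list_length.comp (Primrec.fst.comp (Primrec.snd.comp Primrec.fst)))
    have hA : Primrec (fun a : ((List Bool × (List Bool × List Bool × List Bool)) × List Bool) ×
        List Bool => a.1.1) := Primrec.fst.comp Primrec.fst
    have hq : Primrec (fun a : ((List Bool × (List Bool × List Bool × List Bool)) × List Bool) ×
        List Bool => a.1.1.2.1) := Primrec.fst.comp (Primrec.snd.comp hA)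
    have hw : Primrec (fun a : ((List Bool × (List Bool × List Bool × List Bool)) × List Bool) ×
        List Bool => a.1.1.2.2.1) :=
      Primrec.fst.comp (Primrec.snd.comp (Primrec.snd.comp hA))
    have hs : Primrec (fun a : ((List Bool × (List Bool × List Bool × List Bool)) × List Bool) ×
        List Bool => a.1.1.2.2.2) :=
      Primrec.snd.comp (Primrec.snd.comp (Primrec.snd.comp hA))
    refine partrec_guard ?_ (Computable.partrec hs.to_comp)
    refine Primrec.and.to_comp.comp (Primrec.to_comp ?_) ?_
    · exact Primrec.and.comp
        (primrec_lbeq.comp (Primrec.list_append.comp hq hw) (Primrec.fst.comp hA))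
        (primrec_lbeq.comp Primrec.snd hq)
    · exact computable_lbeq (computable_pair_b hbc
        (Primrec.list_length.comp (Primrec.fst.comp hA)) hs) (Primrec.snd.comp Primrec.fst).to_comp
  have mf : ∀ p q w s s', s' ∈ f (p, (q, w, s)) ↔ s' = s ∧ q ++ w = p ∧
      b (strOfNat p.length, s) ∈ U q ∧ q ∈ G (b (strOfNat p.length, s), q.length) := by
    intro p q w s s'
    simp only [f, Part.mem_bind_iff, mem_guard, Bool.and_eq_true, beq_iff_eq, Part.mem_some_iff]
    constructor
    · rintro ⟨x, hx, q', hq', ⟨⟨h1, rfl⟩, rfl⟩, h3⟩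
      exact ⟨h3, h1, hx, hq'⟩
    · rintro ⟨h1, h2, h3, h4⟩
      exact ⟨_, h3, _, h4, ⟨⟨h2, rfl⟩, rfl⟩, h1⟩
  obtain ⟨V, hV, V1, V2⟩ := exists_selector f hf
  have hV1 : ∀ p s, s ∈ V p → ∃ q w, q ++ w = p ∧ b (strOfNat p.length, s) ∈ U q ∧
        q ∈ G (b (strOfNat p.length, s), q.length) := by
    intro p s h
    obtain ⟨⟨q, w, s'⟩, h'⟩ := V1 _ _ h
    obtain ⟨rfl, h''⟩ := (mf _ _ _ _ _).1 h'
    exact ⟨q, w, h''⟩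
  have huniq : ∀ (r p p' q q' s s' : List Bool), q <+: r → q' <+: r →
      b (strOfNat (List.length p), s) ∈ U q → b (strOfNat (List.length p'), s') ∈ U q' →
      p.length = p'.length ∧ s = s' := by
    intro r p p' q q' s s' h1 h2 h3 h4
    have e := prefix_of_two hU.1.2 (Part.dom_iff_mem.2 ⟨_, h3⟩) (Part.dom_iff_mem.2 ⟨_, h4⟩) h1 h2
    subst e
    have := hb.1 (Part.mem_unique h3 h4)
    simp only [Prod.mk.injEq] at this
    exact ⟨strOfNat_inj this.1, this.2⟩
  refine ⟨V, G, ⟨hV, ?_⟩, ?_, ?_⟩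
  · intro p hp p' hp' hpp
    obtain ⟨y, hy⟩ := Part.dom_iff_mem.1 hp
    obtain ⟨y', hy'⟩ := Part.dom_iff_mem.1 hp'
    obtain ⟨q, w, e, h1, -⟩ := hV1 _ _ hy
    obtain ⟨q', w', e', h1', -⟩ := hV1 _ _ hy'
    have := huniq p' p p' q q' y y' (List.IsPrefix.trans ⟨w, e⟩ hpp) ⟨w', e'⟩ h1 h1'
    exact hpp.eq_of_length this.1
  · intro x q hx
    obtain ⟨q', hq'⟩ := G2 (x, q.length) q q ((mf0 _ _ _ _).2 ⟨hx, rfl, rfl⟩)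
    obtain ⟨q'', h⟩ := G1 _ _ hq'
    obtain ⟨h1, h2, rfl⟩ := (mf0 _ _ _ _).1 h
    exact ⟨q', hq', h1, h2⟩
  · intro p s
    refine ⟨hV1 p s, ?_⟩
    rintro ⟨q, w, e, h1, h2⟩
    obtain ⟨s', hs'⟩ := V2 p (q, w, s) s ((mf _ _ _ _ _).2 ⟨rfl, e, h1, h2⟩)
    obtain ⟨q', w', e', h1', -⟩ := hV1 _ _ hs'
    have := huniq p p p q q' s s' ⟨w, e⟩ ⟨w', e'⟩ h1 h1'
    rwa [this.2]

/-- Binary strings of length `k`. -/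
def strs (k : ℕ) : Finset (List Bool) :=
  Finset.univ.image (fun v : List.Vector Bool k => v.toList)

theorem mem_strs {k : ℕ} {w : List Bool} : w ∈ strs k ↔ w.length = k := by
  simp only [strs, Finset.mem_image, Finset.mem_univ, true_and]
  constructor
  · rintro ⟨v, rfl⟩
    exact v.2
  · intro h
    exact ⟨⟨w, h⟩, rfl⟩

theorem card_strs (k : ℕ) : (strs k).card = 2 ^ k := by
  have hinj : Function.Injective (fun v : List.Vector Bool k => v.toList) :=
    fun a b h => Subtype.ext h
  rw [strs, Finset.card_image_of_injective _ hinj]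
  simp

theorem sum_bound (n : ℕ) : ∑ m ∈ Finset.range (n + 1), 2 ^ (m + (n - m) / 2) ≤ 3 * 2 ^ n := by
  induction n using Nat.twoStepInduction with
  | zero => simp
  | one => simp [Finset.sum_range_succ]
  | more n ih _ =>
    rw [Finset.sum_range_succ, Finset.sum_range_succ]
    have : ∑ m ∈ Finset.range (n + 1), 2 ^ (m + (n + 2 - m) / 2) =
        2 * ∑ m ∈ Finset.range (n + 1), 2 ^ (m + (n - m) / 2) := by
      rw [Finset.mul_sum]
      refine Finset.sum_congr rfl fun m hm => ?_
      rw [Finset.mem_range] at hm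
      rw [← pow_succ']
      congr 1
      omega
    rw [this]
    have e1 : n + 1 + (n + 2 - (n + 1)) / 2 = n + 1 := by omega
    have e2 : n + 2 + (n + 2 - (n + 2)) / 2 = n + 2 := by omega
    rw [e1, e2, pow_succ, pow_succ]
    omega

/-- There is an optimal prefix-free machine `V` with `#S_V(n,s) = 2^(n − H(n,s) + O(1))`,
where `H(n,s) = H_U(b(n,s))` for a fixed optimal `U` and recursive pairing bijection `b`. -/
theorem exists_optimal_card_S_eq (U : List Bool →. List Bool) (hU : OptimalPFM U)
    (b : List Bool × List Bool → List Bool) (hb : Function.Bijective b)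
    (hbc : Computable b) :
    ∃ V : List Bool →. List Bool, OptimalPFM V ∧ ∃ d : ℕ,
      (∀ (n : ℕ) (s : List Bool),
        ({p : List Bool | p.length ≤ n ∧ s ∈ V p}.ncard : ℝ) ≤
          2 ^ ((n : ℤ) - ((Hm U (b (strOfNat n, s))).toNat : ℤ) + d)) ∧
      (∀ (n : ℕ) (s : List Bool), (Hm U (b (strOfNat n, s))).toNat + d ≤ n →
        (2 : ℝ) ^ ((n : ℤ) - ((Hm U (b (strOfNat n, s))).toNat : ℤ) - d) ≤
          ({p : List Bool | p.length ≤ n ∧ s ∈ V p}.ncard : ℝ)) := by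
  classical
  obtain ⟨V, G, hV, hG, mV⟩ := exists_V U hU b hb hbc
  obtain ⟨c1, hc1⟩ := Hm_shift_one U hU b hbc
  obtain ⟨c2, hc2⟩ := Hm_shift_two U hU b hb hbc
  -- minimal selected programs
  have hmin : ∀ n s, ∃ q, b (strOfNat n, s) ∈ U q ∧
      q.length = (Hm U (b (strOfNat n, s))).toNat ∧ q ∈ G (b (strOfNat n, s), q.length) := by
    intro n s
    obtain ⟨q, hq, hl⟩ := Hm_attained U hU (b (strOfNat n, s))
    obtain ⟨q', h1, h2, h3⟩ := hG _ _ hq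
    exact ⟨q', h2, h3.trans hl, h3 ▸ h1⟩
  have hfin : ∀ (n : ℕ) (s : List Bool), {p : List Bool | p.length ≤ n ∧ s ∈ V p}.Finite := by
    intro n s
    exact (List.finite_length_le Bool n).subset fun p hp => hp.1
  refine ⟨V, ⟨hV, ?_⟩, c2 + 3, ?_, ?_⟩
  · intro C hC
    obtain ⟨d, hd⟩ := hU.2 C hC
    refine ⟨d + 2 * c1, fun p s hs => ?_⟩
    obtain ⟨q, hq, hl⟩ := hd p s hs
    have h1 := hc1 (2 * c1) q s hq
    obtain ⟨r, hr, hrl, hrG⟩ := hmin (q.length + 2 * c1) s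
    have hlen : (r ++ List.replicate (q.length + 2 * c1 - r.length) false).length =
        q.length + 2 * c1 := by
      rw [List.length_append, List.length_replicate]
      omega
    refine ⟨r ++ List.replicate (q.length + 2 * c1 - r.length) false, ?_, ?_⟩
    · rw [mV, hlen]
      exact ⟨r, _, rfl, hr, hrG⟩
    · rw [hlen]
      omega
  · intro n s
    have hT : ∀ m ≤ n, ((strs m).filter (fun p => s ∈ V p)).card *
        2 ^ (Hm U (b (strOfNat n, s))).toNat ≤ 2 ^ (m + (n - m) / 2) * 2 ^ (c2 + 1) := by
      intro m hm
      set H := (Hm U (b (strOfNat m, s))).toNat with hH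
      have hsub : (strs m).filter (fun p => s ∈ V p) ⊆
          (Finset.Ico H (m + 1)).biUnion (fun l => (strs (m - l)).image
            (fun w => (if h : (G (b (strOfNat m, s), l)).Dom then
              (G (b (strOfNat m, s), l)).get h else []) ++ w)) := by
        intro p hp
        rw [Finset.mem_filter, mem_strs, mV] at hp
        obtain ⟨hpm, q, w, e, h1, h2⟩ := hp
        rw [hpm] at h1 h2
        have hlen : q.length + w.length = m := by rw [← hpm, ← e, List.length_append]
        rw [Finset.mem_biUnion]
        refine ⟨q.length, ?_, ?_⟩
        · rw [Finset.mem_Ico]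
          exact ⟨Hm_le U h1, by omega⟩
        · rw [Finset.mem_image]
          refine ⟨w, mem_strs.2 (by omega), ?_⟩
          obtain ⟨hd, hq⟩ := h2
          rw [dif_pos hd, hq, e]
      have hcard : ((strs m).filter (fun p => s ∈ V p)).card * 2 ^ H ≤ 2 ^ (m + 1) := by
        have hb1 : ((strs m).filter (fun p => s ∈ V p)).card ≤
            ∑ l ∈ Finset.Ico H (m + 1), 2 ^ (m - l) := by
          refine (Finset.card_le_card hsub).trans (Finset.card_biUnion_le.trans ?_)
          refine Finset.sum_le_sum fun l _ => ?_
          exact Finset.card_image_le.trans (card_strs _).le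
        refine (Nat.mul_le_mul_right _ hb1).trans ?_
        by_cases hHm : H ≤ m
        · have : ∑ l ∈ Finset.Ico H (m + 1), 2 ^ (m - l) ≤ 2 ^ (m + 1 - H) := by
            have h3 : ∑ l ∈ Finset.Ico H (m + 1), 2 ^ (m - l) =
                ∑ i ∈ Finset.range (m + 1 - H), 2 ^ i := by
              rw [Finset.sum_Ico_eq_sum_range, ← Finset.sum_range_reflect]
              refine Finset.sum_congr rfl fun i hi => ?_
              rw [Finset.mem_range] at hi
              congr 1
              omega
            rw [h3]
            have := Nat.geomSum_lt (m := 2) le_rfl (s := Finset.range (m + 1 - H))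
              (n := m + 1 - H) (fun k hk => Finset.mem_range.1 hk)
            exact this.le
          refine (Nat.mul_le_mul_right _ this).trans ?_
          rw [← pow_add]
          exact Nat.pow_le_pow_right (by norm_num) (by omega)
        · rw [Finset.Ico_eq_empty (by omega)]
          simp
      have h4 := hc2 (n - m) m s
      rw [Nat.add_sub_cancel' hm] at h4
      calc _ ≤ ((strs m).filter (fun p => s ∈ V p)).card * 2 ^ (H + (n - m) / 2 + c2) :=
            Nat.mul_le_mul_left _ (Nat.pow_le_pow_right (by norm_num) h4)
        _ = (((strs m).filter (fun p => s ∈ V p)).card * 2 ^ H) * 2 ^ ((n - m) / 2 + c2) := by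
            rw [mul_assoc, ← pow_add, add_assoc]
        _ ≤ 2 ^ (m + 1) * 2 ^ ((n - m) / 2 + c2) := Nat.mul_le_mul_right _ hcard
        _ = _ := by
            rw [← pow_add, ← pow_add]
            congr 1
            omega
    have hS : {p : List Bool | p.length ≤ n ∧ s ∈ V p}.ncard ≤
        ∑ m ∈ Finset.range (n + 1), ((strs m).filter (fun p => s ∈ V p)).card := by
      refine le_trans ?_ Finset.card_biUnion_le
      rw [← Set.ncard_coe_finset]
      refine Set.ncard_le_ncard ?_ (Finset.finite_toSet _)
      intro p hp
      rw [Finset.mem_coe, Finset.mem_biUnion]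
      exact ⟨p.length, Finset.mem_range.2 (Nat.lt_succ_of_le hp.1),
        Finset.mem_filter.2 ⟨mem_strs.2 rfl, hp.2⟩⟩
    have hfinal : {p : List Bool | p.length ≤ n ∧ s ∈ V p}.ncard *
        2 ^ (Hm U (b (strOfNat n, s))).toNat ≤ 2 ^ (n + (c2 + 3)) := by
      refine (Nat.mul_le_mul_right _ hS).trans ?_
      rw [Finset.sum_mul]
      calc _ ≤ ∑ m ∈ Finset.range (n + 1), 2 ^ (m + (n - m) / 2) * 2 ^ (c2 + 1) :=
            Finset.sum_le_sum fun m hm => hT m (Nat.lt_succ_iff.1 (Finset.mem_range.1 hm))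
        _ ≤ (3 * 2 ^ n) * 2 ^ (c2 + 1) := by
            rw [← Finset.sum_mul]
            exact Nat.mul_le_mul_right _ (sum_bound n)
        _ ≤ (4 * 2 ^ n) * 2 ^ (c2 + 1) := by gcongr; norm_num
        _ = _ := by ring
    have hR : ({p : List Bool | p.length ≤ n ∧ s ∈ V p}.ncard : ℝ) *
        2 ^ (Hm U (b (strOfNat n, s))).toNat ≤ 2 ^ (n + (c2 + 3)) := by
      exact_mod_cast hfinal
    have e : (2 : ℝ) ^ ((n : ℤ) - ((Hm U (b (strOfNat n, s))).toNat : ℤ) + (c2 + 3 : ℕ)) =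
        2 ^ (n + (c2 + 3)) / 2 ^ (Hm U (b (strOfNat n, s))).toNat := by
      rw [show (n : ℤ) - ((Hm U (b (strOfNat n, s))).toNat : ℤ) + (c2 + 3 : ℕ) =
        ((n + (c2 + 3) : ℕ) : ℤ) - ((Hm U (b (strOfNat n, s))).toNat : ℤ) by push_cast; ring,
        zpow_sub₀ two_ne_zero, zpow_natCast, zpow_natCast]
    rw [e, le_div_iff₀ (by positivity)]
    exact hR
  · intro n s hn
    obtain ⟨q, hq, hl, hqG⟩ := hmin n s
    have hN : 2 ^ (n - q.length) ≤ {p : List Bool | p.length ≤ n ∧ s ∈ V p}.ncard := by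
      rw [← card_strs, ← Finset.card_image_of_injective (strs (n - q.length))
        (List.append_right_injective q), ← Set.ncard_coe_finset]
      refine Set.ncard_le_ncard ?_ (hfin n s)
      intro p hp
      rw [Finset.mem_coe, Finset.mem_image] at hp
      obtain ⟨w, hw, rfl⟩ := hp
      rw [mem_strs] at hw
      have hlen : (q ++ w).length = n := by
        rw [List.length_append]
        omega
      refine ⟨hlen.le, ?_⟩
      rw [mV, hlen]
      exact ⟨q, w, rfl, hq, hqG⟩
    have hR : (2 : ℝ) ^ (n - q.length) ≤
        ({p : List Bool | p.length ≤ n ∧ s ∈ V p}.ncard : ℝ) := by exact_mod_cast hN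
    refine le_trans ?_ hR
    rw [← zpow_natCast]
    refine zpow_le_zpow_right₀ (by norm_num) ?_
    rw [← hl]
    push_cast
    omega
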